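/- The spider tree Y_3, consisting of a center vertex with three pendant paths of length 3 attached to it, admits no (1,4,4,4)-packing coloring. -/

import Mathlib

/-- `c` is an `s`-packing coloring of the simple graph `G`: for each color `i`, any two
distinct vertices with color `i` are at graph distance strictly greater than `s i`
(vertices in different connected components trivially satisfy this). -/
def IsPackingColoring {V : Type*} (G : SimpleGraph V) {k : ℕ} (s : Fin k → ℕ)
    (c : V → Fin k) : Prop :=
  ∀ u v : V, u ≠ v → c u = c v → G.Reachable u v → s (c u) < G.dist u v

/-- The spider tree `Y₃`: a center (vertex `0`) with three pendant paths of length `3`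
(legs `1-2-3`, `4-5-6`, `7-8-9`). -/
def spiderY3 : SimpleGraph (Fin 10) :=
  SimpleGraph.fromRel (fun u v =>
    (u, v) ∈ ([(0,1),(1,2),(2,3),
               (0,4),(4,5),(5,6),
               (0,7),(7,8),(8,9)] : List (Fin 10 × Fin 10)))

instance : DecidableRel spiderY3.Adj := fun u v =>
  decidable_of_iff _ (SimpleGraph.fromRel_adj _ u v).symm

/-- There is a walk of length at most `n` from `u` to `v`. -/
def SimpleGraph.WalkWithin {V : Type*} (G : SimpleGraph V) : ℕ → V → V → Prop
  | 0, u, v => u = v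
  | n + 1, u, v => u = v ∨ ∃ w, G.Adj u w ∧ G.WalkWithin n w v

instance SimpleGraph.decidableWalkWithin {V : Type*} [Fintype V] [DecidableEq V]
    (G : SimpleGraph V) [DecidableRel G.Adj] : ∀ n u v, Decidable (G.WalkWithin n u v)
  | 0, u, v => inferInstanceAs (Decidable (u = v))
  | n + 1, u, v =>
    haveI : ∀ w, Decidable (G.WalkWithin n w v) := fun w => G.decidableWalkWithin n w v
    inferInstanceAs (Decidable (u = v ∨ ∃ w, G.Adj u w ∧ G.WalkWithin n w v))

theorem SimpleGraph.WalkWithin.exists_walk {V : Type*} {G : SimpleGraph V} {n : ℕ} {u v : V}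
    (h : G.WalkWithin n u v) : ∃ p : G.Walk u v, p.length ≤ n := by
  induction n generalizing u with
  | zero => obtain rfl : u = v := h; exact ⟨.nil, le_rfl⟩
  | succ n ih =>
    obtain rfl | ⟨w, hw, hv⟩ := h
    · exact ⟨.nil, Nat.zero_le _⟩
    · obtain ⟨p, hp⟩ := ih hv
      exact ⟨.cons hw p, Nat.succ_le_succ hp⟩

/-- In a packing coloring, vertices joined by a walk of length at most `s i` cannot both have
color `i`. -/
theorem IsPackingColoring.ne_of_walkWithin {V : Type*} {G : SimpleGraph V} {k : ℕ}
    {s : Fin k → ℕ} {c : V → Fin k} (hc : IsPackingColoring G s c) {u v : V} (huv : u ≠ v)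
    {i : Fin k} (h : G.WalkWithin (s i) u v) (hu : c u = i) : c v ≠ i := by
  rintro hv
  obtain ⟨p, hp⟩ := h.exists_walk
  have h₁ := hc u v huv (hu.trans hv.symm) p.reachable
  rw [hu] at h₁
  exact absurd (h₁.trans_le (SimpleGraph.dist_le p)) hp.not_gt

/-- `Y₃` admits no `(1,4,4,4)`-packing coloring. -/
theorem spiderY3_not_1444_colorable :
    ¬ ∃ c : Fin 10 → Fin 4, IsPackingColoring spiderY3 ![1, 4, 4, 4] c := by
  rintro ⟨c, hc⟩
  have adj {u v : Fin 10} (huv : u ≠ v ∧ spiderY3.WalkWithin 1 u v) : c u ≠ 0 ∨ c v ≠ 0 :=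
    or_iff_not_imp_left.2 fun h => hc.ne_of_walkWithin huv.1 huv.2 (not_not.1 h)
  -- Four vertices pairwise within distance `4` cannot all avoid the first color.
  have clique (u v w x : Fin 10)
      (h : [u, v, w, x].Pairwise fun a b => a ≠ b ∧ spiderY3.WalkWithin 4 a b)
      (hu : c u ≠ 0) (hv : c v ≠ 0) (hw : c w ≠ 0) (hx : c x ≠ 0) : False := by
    have near {a b : Fin 10} (hab : a ≠ b ∧ spiderY3.WalkWithin 4 a b) (ha : c a ≠ 0) :
        c b ≠ c a := by
      refine hc.ne_of_walkWithin hab.1 ?_ rfl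
      generalize c a = i at ha
      fin_cases i
      · exact absurd rfl ha
      all_goals exact hab.2
    simp only [List.pairwise_cons, List.mem_cons, List.not_mem_nil, or_false, forall_eq_or_imp,
      forall_eq] at h
    obtain ⟨⟨huv, huw, hux⟩, ⟨hvw, hvx⟩, hwx, -⟩ := h
    have := near huv hu
    have := near huw hu
    have := near hux hu
    have := near hvw hv
    have := near hvx hv
    have := near hwx hw
    omega
  by_cases h0 : c 0 = 0
  · have nbr {v : Fin 10} (hv : 0 ≠ v ∧ spiderY3.WalkWithin 1 0 v) : c v ≠ 0 :=
      (adj hv).resolve_left (not_not.2 h0)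
    have h1 := nbr (v := 1) (by decide)
    have h4 := nbr (v := 4) (by decide)
    have h7 := nbr (v := 7) (by decide)
    rcases adj (u := 2) (v := 3) (by decide) with h | h <;>
      exact clique _ _ _ _ (by decide) h h1 h4 h7
  · rcases adj (u := 1) (v := 2) (by decide) with h1 | h1 <;>
    rcases adj (u := 4) (v := 5) (by decide) with h2 | h2 <;>
    rcases adj (u := 7) (v := 8) (by decide) with h3 | h3 <;>
      exact clique _ _ _ _ (by decide) h0 h1 h2 h3
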